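/- arXiv:1306.1868 — 2 statements merged into one kernel-verified Lean document; each statement's English description precedes it below -/
import Mathlib

section
/- A function f̂ ∈ W^m_2 minimizes ψ over W^m_2 if and only if both of the following hold: (i) (−1)^m λ ρ(t) f̂^{(m)}(t) + ľ_m(f̂, t) = ľ_m(h, t) for Lebesgue-almost every t ∈ [0,1]; and (ii) ľ_k(f̂, 1) = ľ_k(h, 1) for all k = 1, …, m. -/
open MeasureTheory Set

noncomputable section

/-- `MemW m f fm` says that `f` belongs to the Sobolev class `W^m_2` on `[0,1]`:
`f` is `(m-1)`-times continuously differentiable on `[0,1]`, its `(m-1)`-th derivative is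
absolutely continuous with a.e. derivative `fm` (expressed as the integral representation),
and `fm ∈ L²[0,1]`. -/
def MemW (m : ℕ) (f fm : ℝ → ℝ) : Prop :=
  ContDiffOn ℝ (m - 1 : ℕ) f (Icc 0 1) ∧
  IntegrableOn (fun s => fm s ^ 2) (Icc (0 : ℝ) 1) volume ∧
  ∀ x ∈ Icc (0 : ℝ) 1,
    iteratedDerivWithin (m - 1) f (Icc (0 : ℝ) 1) x =
      iteratedDerivWithin (m - 1) f (Icc (0 : ℝ) 1) 0 + ∫ s in (0 : ℝ)..x, fm s

/-- The penalized least squares functional `ψ`, evaluated on `f ∈ W^m_2` whose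
a.e. `m`-th derivative is `fm`. -/
def psi (n : ℕ) (t y : Fin n → ℝ) (σ ρ : ℝ → ℝ) (lam : ℝ) (f fm : ℝ → ℝ) : ℝ :=
  (1 / n) * ∑ i, (σ (t i) ^ 2)⁻¹ * (y i - f (t i)) ^ 2 +
    lam * ∫ s in (0 : ℝ)..1, ρ s * fm s ^ 2

/-- The iterated empirical integrals: `lcheck n t σ v k` is `ľ_{k+1}(·)` from the paper,
where `v i` plays the role of the value at the design point `t i` (e.g. `v i = f (t i)`,
or `v i = y i` for `ľ_k(h, ·)`).  Thus
`lcheck n t σ v 0 x = (1/n) ∑ᵢ σ(tᵢ)⁻² vᵢ 𝟙{tᵢ ≤ x}` and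
`lcheck n t σ v (k+1) x = ∫₀ˣ lcheck n t σ v k s ds`. -/
def lcheck (n : ℕ) (t : Fin n → ℝ) (σ : ℝ → ℝ) (v : Fin n → ℝ) : ℕ → ℝ → ℝ
  | 0 => fun x => (1 / n) * ∑ i, (σ (t i) ^ 2)⁻¹ * v i * (if t i ≤ x then 1 else 0)
  | (k + 1) => fun x => ∫ s in (0 : ℝ)..x, lcheck n t σ v k s


lemma aux_sq_int {g : ℝ → ℝ} {x : ℝ} (hx : x ∈ Icc (0:ℝ) 1)
    (hm : AEStronglyMeasurable g (volume.restrict (Ioc 0 x)))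
    (h2 : IntegrableOn (fun s => g s ^ 2) (Icc (0 : ℝ) 1) volume) :
    IntervalIntegrable g volume 0 x := by
  rw [intervalIntegrable_iff_integrableOn_Ioc_of_le hx.1]
  have h3 : IntegrableOn (fun s => 1 + g s ^ 2) (Ioc 0 x) volume := by
    apply Integrable.add
    · exact integrableOn_const (by simp)
    · exact h2.mono_set (fun s hs => ⟨hs.1.le, hs.2.trans hx.2⟩)
  refine Integrable.mono' h3 hm (Filter.Eventually.of_forall fun s => ?_)
  rw [Real.norm_eq_abs, abs_le]
  constructor <;> nlinarith [sq_nonneg (g s - 1), sq_nonneg (g s + 1)]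

lemma aux_ibp {l v U : ℝ → ℝ} (hl : IntervalIntegrable l volume 0 1)
    (hv : IntervalIntegrable v volume 0 1)
    (hU : ∀ x ∈ Icc (0:ℝ) 1, U x = U 0 + ∫ s in (0:ℝ)..x, v s) :
    ∫ x in (0:ℝ)..1, l x * U x =
      (∫ x in (0:ℝ)..1, l x) * U 1 - ∫ x in (0:ℝ)..1, (∫ s in (0:ℝ)..x, l s) * v x := by
  have h01 : (0:ℝ) ∈ uIcc (0:ℝ) 1 := by simp
  have acL := hl.absolutelyContinuousOnInterval_intervalIntegral h01
  have acV := hv.absolutelyContinuousOnInterval_intervalIntegral h01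
  have acC : AbsolutelyContinuousOnInterval (fun _ : ℝ => U 0) 0 1 :=
    (contDiff_const.contDiffOn (n := 1)).absolutelyContinuousOnInterval
  have acU := acC.fun_add acV
  have key := acL.integral_mul_deriv_eq_deriv_mul acU
  have e1 : ∫ x in (0:ℝ)..1, (∫ s in (0:ℝ)..x, l s) * deriv (fun x => U 0 + ∫ s in (0:ℝ)..x, v s) x
      = ∫ x in (0:ℝ)..1, (∫ s in (0:ℝ)..x, l s) * v x := by
    apply intervalIntegral.integral_congr_ae
    filter_upwards [hv.ae_hasDerivAt_integral] with x hx hx'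
    have := (hx (uIoc_subset_uIcc hx') 0 h01).const_add (U 0)
    rw [this.deriv]
  have e2 : ∫ x in (0:ℝ)..1, deriv (fun x => ∫ s in (0:ℝ)..x, l s) x * (U 0 + ∫ s in (0:ℝ)..x, v s)
      = ∫ x in (0:ℝ)..1, l x * U x := by
    apply intervalIntegral.integral_congr_ae
    filter_upwards [hl.ae_hasDerivAt_integral] with x hx hx'
    have hx2 := uIoc_subset_uIcc hx'
    rw [(hx hx2 0 h01).deriv, hU x (by rwa [uIcc_of_le zero_le_one] at hx2)]
  rw [e1, e2] at key
  rw [key, hU 1 (by simp)]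
  simp

lemma aux_base {v U : ℝ → ℝ} (hv : IntervalIntegrable v volume 0 1)
    (hU : ∀ x ∈ Icc (0:ℝ) 1, U x = U 0 + ∫ s in (0:ℝ)..x, v s) {t : ℝ} (ht : t ∈ Icc (0:ℝ) 1) :
    IntervalIntegrable (fun x => (if t ≤ x then (1:ℝ) else 0) * v x) volume 0 1 ∧
    U t = U 1 - ∫ x in (0:ℝ)..1, (if t ≤ x then (1:ℝ) else 0) * v x := by
  have hfun : (fun x => (if t ≤ x then (1:ℝ) else 0) * v x) = (Ici t).indicator v := by
    ext x; by_cases h : t ≤ x <;> simp [h]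
  have hv' := hv
  rw [intervalIntegrable_iff_integrableOn_Ioc_of_le zero_le_one] at hv'
  have h0t : IntervalIntegrable v volume 0 t := by
    rw [intervalIntegrable_iff_integrableOn_Ioc_of_le ht.1]
    exact hv'.mono_set (Ioc_subset_Ioc_right ht.2)
  have ht1 : IntervalIntegrable v volume t 1 := by
    rw [intervalIntegrable_iff_integrableOn_Ioc_of_le ht.2]
    exact hv'.mono_set (Ioc_subset_Ioc_left ht.1)
  rw [hfun]
  refine ⟨?_, ?_⟩
  · rw [intervalIntegrable_iff_integrableOn_Ioc_of_le zero_le_one]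
    exact Integrable.indicator hv' measurableSet_Ici
  · have hI : ∫ x in (0:ℝ)..1, (Ici t).indicator v x = ∫ x in t..1, v x := by
      rw [intervalIntegral.integral_of_le zero_le_one, intervalIntegral.integral_of_le ht.2,
        setIntegral_indicator measurableSet_Ici]
      apply setIntegral_congr_set
      have : ∀ᵐ x : ℝ, x ≠ t ∧ x ≠ 0:= by
        filter_upwards [Measure.ae_ne volume t, Measure.ae_ne volume 0] with x h1 h2 using ⟨h1, h2⟩
      filter_upwards [this] with x hx
      apply propext
      change (x ∈ Ioc (0:ℝ) 1 ∩ Ici t) ↔ x ∈ Ioc t 1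
      simp only [mem_inter_iff, mem_Ioc, mem_Ici]
      constructor
      · rintro ⟨⟨a, b⟩, c⟩; exact ⟨lt_of_le_of_ne c hx.1.symm, b⟩
      · rintro ⟨a, b⟩; exact ⟨⟨lt_of_le_of_lt ht.1 a, b⟩, a.le⟩
    rw [hI, hU t ht, hU 1 (by simp), ← intervalIntegral.integral_add_adjacent_intervals h0t ht1]
    ring

lemma lcheck_int (n : ℕ) (t : Fin n → ℝ) (σ : ℝ → ℝ) (v : Fin n → ℝ) (k : ℕ) (a b : ℝ) :
    IntervalIntegrable (lcheck n t σ v k) volume a b := by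
  induction k generalizing a b with
  | zero =>
    have : lcheck n t σ v 0 = ∑ i, fun x => (1 / n) * ((σ (t i) ^ 2)⁻¹ * v i) * (if t i ≤ x then (1:ℝ) else 0) := by
      ext x
      simp only [lcheck, Finset.mul_sum, Finset.sum_apply, mul_assoc]
    rw [this]
    refine IntervalIntegrable.sum _ fun i _ => IntervalIntegrable.const_mul ?_ _
    apply Monotone.intervalIntegrable
    intro x y hxy
    dsimp only
    split_ifs with h1 h2 <;> first | simp | exact absurd (h1.trans hxy) h2
  | succ k ih =>
    exact (intervalIntegral.continuous_primitive ih 0).intervalIntegrable a b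

lemma lcheck_sub (n : ℕ) (t : Fin n → ℝ) (σ : ℝ → ℝ) (v w : Fin n → ℝ) (k : ℕ) (x : ℝ) :
    lcheck n t σ (fun i => v i - w i) k x = lcheck n t σ v k x - lcheck n t σ w k x := by
  induction k generalizing x with
  | zero =>
    simp only [lcheck, ← mul_sub, ← Finset.sum_sub_distrib]
    congr 1
    refine Finset.sum_congr rfl fun i _ => ?_
    ring
  | succ k ih =>
    simp only [lcheck, ih]
    exact intervalIntegral.integral_sub (lcheck_int ..) (lcheck_int ..)

lemma aux_formula (n : ℕ) (t : Fin n → ℝ) (ht : ∀ i, t i ∈ Icc (0 : ℝ) 1) (σ : ℝ → ℝ)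
    (v : Fin n → ℝ) (u : ℕ → ℝ → ℝ) (p : ℕ)
    (hi : ∀ k < p + 1, IntervalIntegrable (u (k+1)) volume 0 1)
    (hu : ∀ k < p + 1, ∀ x ∈ Icc (0:ℝ) 1, u k x = u k 0 + ∫ s in (0:ℝ)..x, u (k+1) s) :
    (1 / n) * ∑ i, (σ (t i) ^ 2)⁻¹ * v i * u 0 (t i) =
      ∑ k ∈ Finset.range (p+1), (-1:ℝ)^k * lcheck n t σ v k 1 * u k 1 +
        (-1:ℝ)^(p+1) * ∫ x in (0:ℝ)..1, lcheck n t σ v p x * u (p+1) x := by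
  induction p with
  | zero =>
    have hb := fun i => aux_base (hi 0 (by simp)) (hu 0 (by simp)) (ht i)
    have e : ∫ x in (0:ℝ)..1, lcheck n t σ v 0 x * u (0+1) x =
        ∑ i, (1 / n) * ((σ (t i) ^ 2)⁻¹ * v i) *
          ∫ x in (0:ℝ)..1, (if t i ≤ x then (1:ℝ) else 0) * u (0+1) x := by
      simp_rw [← intervalIntegral.integral_const_mul]
      rw [← intervalIntegral.integral_finsetSum]
      · congr 1; ext x
        simp only [lcheck, Finset.mul_sum, Finset.sum_mul]
        refine Finset.sum_congr rfl fun i _ => ?_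
        ring
      · intro i _
        exact (hb i).1.const_mul _
    rw [e]
    simp only [zero_add, Finset.sum_range_one, pow_zero, one_mul, lcheck, pow_one]
    rw [Finset.mul_sum, neg_one_mul, ← sub_eq_add_neg, Finset.mul_sum, Finset.sum_mul, ← Finset.sum_sub_distrib]
    refine Finset.sum_congr rfl fun i _ => ?_
    rw [(hb i).2, if_pos (ht i).2]
    ring
  | succ p ih =>
    rw [ih (fun k hk => hi k (by omega)) (fun k hk => hu k (by omega)),
      aux_ibp (lcheck_int n t σ v p 0 1) (hi (p+1) (by omega)) (hu (p+1) (by omega)),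
      Finset.sum_range_succ _ (p+1)]
    simp only [lcheck]
    ring

lemma aux_formula' (n : ℕ) (t : Fin n → ℝ) (ht : ∀ i, t i ∈ Icc (0 : ℝ) 1) (σ : ℝ → ℝ)
    (v : Fin n → ℝ) (p : ℕ) (h hm : ℝ → ℝ) (hh : MemW (p+1) h hm)
    (hi : IntervalIntegrable hm volume 0 1) :
    (1 / n) * ∑ i, (σ (t i) ^ 2)⁻¹ * v i * h (t i) =
      ∑ k ∈ Finset.range (p+1), (-1:ℝ)^k * lcheck n t σ v k 1 *
        iteratedDerivWithin k h (Icc 0 1) 1 +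
        (-1:ℝ)^(p+1) * ∫ x in (0:ℝ)..1, lcheck n t σ v p x * hm x := by
  obtain ⟨hc, h2, hr⟩ := hh
  simp only [Nat.add_sub_cancel] at hc hr
  have hud : UniqueDiffOn ℝ (Icc (0:ℝ) 1) := uniqueDiffOn_Icc zero_lt_one
  have hcont : ∀ k ≤ p, ContinuousOn (iteratedDerivWithin k h (Icc 0 1)) (Icc 0 1) := fun k hk =>
    hc.continuousOn_iteratedDerivWithin (by exact_mod_cast hk) hud
  have key := aux_formula n t ht σ v
    (fun k => if k ≤ p then iteratedDerivWithin k h (Icc 0 1) else hm) p ?_ ?_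
  · simp only [Nat.zero_le, if_true, iteratedDerivWithin_zero] at key
    rw [key]
    congr 1
    · refine Finset.sum_congr rfl fun k hk => ?_
      rw [if_pos (by simpa [Nat.lt_succ_iff] using hk)]
    · simp
  · intro k hk
    by_cases hkp : k + 1 ≤ p
    · simp only [hkp, if_true]
      apply ContinuousOn.intervalIntegrable
      rw [uIcc_of_le zero_le_one]
      exact hcont _ hkp
    · simpa only [hkp, if_false]
  · intro k hk x hx
    by_cases hkp : k + 1 ≤ p
    · simp only [hkp, if_true, (by omega : k ≤ p)]
      have := intervalIntegral.integral_eq_sub_of_hasDerivAt_of_le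
        (f := iteratedDerivWithin k h (Icc 0 1)) (f' := iteratedDerivWithin (k+1) h (Icc 0 1)) hx.1
        ((hcont k (by omega)).mono (Icc_subset_Icc_right hx.2)) ?_ ?_
      · rw [this]; ring
      · intro s hs
        have hsI : s ∈ Icc (0:ℝ) 1 := ⟨hs.1.le, hs.2.le.trans hx.2⟩
        have hd : DifferentiableOn ℝ (iteratedDerivWithin k h (Icc 0 1)) (Icc 0 1) :=
          hc.differentiableOn_iteratedDerivWithin (by exact_mod_cast (by omega : k < p)) hud
        have := (hd s hsI).hasDerivWithinAt
        rw [← iteratedDerivWithin_succ] at this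
        exact this.hasDerivAt (Icc_mem_nhds hs.1 (lt_of_lt_of_le hs.2 hx.2))
      · apply ContinuousOn.intervalIntegrable
        rw [uIcc_of_le hx.1]
        exact (hcont _ hkp).mono (Icc_subset_Icc_right hx.2)
    · have : k = p := by omega
      subst this
      simpa using hr x hx

lemma aux_trunc (p : ℕ) (g gm : ℝ → ℝ) (hg : MemW (p+1) g gm) :
    ∃ S : Set ℝ, MemW (p+1) g (S.indicator gm) ∧
      IntervalIntegrable (S.indicator gm) volume 0 1 := by
  obtain ⟨hc, h2, hr⟩ := hg
  simp only [Nat.add_sub_cancel] at hc hr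
  have hud : UniqueDiffOn ℝ (Icc (0:ℝ) 1) := uniqueDiffOn_Icc zero_lt_one
  set D := iteratedDerivWithin p g (Icc 0 1) with hD
  have hDc : ContinuousOn D (Icc 0 1) := hc.continuousOn_iteratedDerivWithin le_rfl hud
  let A : Set ℝ := {x | x ∈ Icc (0:ℝ) 1 ∧ IntervalIntegrable gm volume 0 x}
  have hA0 : (0:ℝ) ∈ A := ⟨by simp, by simp⟩
  have hAb : BddAbove A := ⟨1, fun x hx => hx.1.2⟩
  set a := sSup A with ha
  have ha0 : 0 ≤ a := le_csSup hAb hA0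
  have ha1 : a ≤ 1 := csSup_le ⟨0, hA0⟩ fun x hx => hx.1.2
  obtain ⟨u, -, hut, huA⟩ := exists_seq_tendsto_sSup ⟨0, hA0⟩ hAb
  have haint : IntervalIntegrable gm volume 0 a := by
    refine aux_sq_int ⟨ha0, ha1⟩ ?_ h2
    rw [Measure.restrict_congr_set (Ioo_ae_eq_Ioc (a := (0:ℝ)) (b := a)).symm]
    have hs : Ioo 0 a ⊆ ⋃ k, Ioc 0 (u k) := by
      intro x hx
      obtain ⟨k, hk⟩ := (hut.eventually (lt_mem_nhds hx.2)).exists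
      exact mem_iUnion.2 ⟨k, hx.1, hk.le⟩
    refine AEStronglyMeasurable.mono_measure ?_ (Measure.restrict_mono hs le_rfl)
    rw [aestronglyMeasurable_iUnion_iff]
    intro k
    have := (huA k).2
    rw [intervalIntegrable_iff_integrableOn_Ioc_of_le (huA k).1.1] at this
    exact this.aestronglyMeasurable
  have hDa : D a = D 0 + ∫ s in (0:ℝ)..a, gm s := hr a ⟨ha0, ha1⟩
  have hDx : ∀ x ∈ Icc (0:ℝ) 1, a < x → D x = D 0 := by
    intro x hx hax
    rw [hr x hx, intervalIntegral.integral_undef, add_zero]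
    intro hcon
    exact absurd (le_csSup hAb (show x ∈ A from ⟨hx, hcon⟩)) (not_le.2 hax)
  have hD1 : a < 1 → D a = D 0 := by
    intro h1
    have hl : Filter.Tendsto D (nhdsWithin a (Ioc a 1)) (nhds (D a)) :=
      (hDc a ⟨ha0, ha1⟩).mono (fun x hx => ⟨ha0.trans hx.1.le, hx.2⟩)
    have hl2 : Filter.Tendsto D (nhdsWithin a (Ioc a 1)) (nhds (D 0)) := by
      refine tendsto_const_nhds.congr' ?_
      filter_upwards [self_mem_nhdsWithin] with x hx
      exact (hDx x ⟨ha0.trans hx.1.le, hx.2⟩ hx.1).symm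
    have : (nhdsWithin a (Ioc a 1)).NeBot := by
      rw [nhdsWithin_Ioc_eq_nhdsGT h1]; infer_instance
    exact tendsto_nhds_unique hl hl2
  have hint : ∀ x ∈ Icc (0:ℝ) 1, ∫ s in (0:ℝ)..x, (Iic a).indicator gm s =
      ∫ s in (0:ℝ)..(min x a), gm s := by
    intro x hx
    rw [intervalIntegral.integral_of_le hx.1, intervalIntegral.integral_of_le (le_min hx.1 ha0),
      setIntegral_indicator measurableSet_Iic, Ioc_inter_Iic]
  refine ⟨Iic a, ⟨by simpa using hc, ?_, ?_⟩, ?_⟩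
  · have : (fun s => (Iic a).indicator gm s ^ 2) = (Iic a).indicator (fun s => gm s ^ 2) := by
      ext s; by_cases h : s ∈ Iic a <;> simp [h]
    rw [this]
    exact Integrable.indicator h2 measurableSet_Iic
  · intro x hx
    simp only [Nat.add_sub_cancel, ← hD]
    rw [hint x hx]
    rcases le_or_gt x a with h | h
    · rw [min_eq_left h]; exact hr x hx
    · rw [min_eq_right h.le, hDx x hx h, ← hDa, hD1 (h.trans_le hx.2)]
  · rw [intervalIntegrable_iff_integrableOn_Ioc_of_le zero_le_one]
    rw [intervalIntegrable_iff_integrableOn_Ioc_of_le ha0] at haint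
    change Integrable _ _
    rw [integrable_indicator_iff measurableSet_Iic, IntegrableOn, Measure.restrict_restrict measurableSet_Iic,
      inter_comm, Ioc_inter_Iic, inf_eq_right.2 ha1]
    exact haint

lemma aux_memLin (p : ℕ) {f fm h hm : ℝ → ℝ} (hf : MemW (p+1) f fm) (hh : MemW (p+1) h hm)
    (hfi : IntervalIntegrable fm volume 0 1) (hhi : IntervalIntegrable hm volume 0 1) (ε : ℝ) :
    MemW (p+1) (fun x => f x + ε * h x) (fun x => fm x + ε * hm x) := by
  obtain ⟨hfc, hf2, hfr⟩ := hf
  obtain ⟨hhc, hh2, hhr⟩ := hh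
  have hud : UniqueDiffOn ℝ (Icc (0:ℝ) 1) := uniqueDiffOn_Icc zero_lt_one
  have h1 : ContDiffOn ℝ (p + 1 - 1 : ℕ) (fun x => ε * h x) (Icc 0 1) := contDiffOn_const.mul hhc
  refine ⟨hfc.add h1, ?_, ?_⟩
  · have hfi' := hfi
    have hhi' := hhi
    rw [intervalIntegrable_iff_integrableOn_Icc_of_le zero_le_one] at hfi' hhi'
    refine Integrable.mono' ((hf2.const_mul 2).add (hh2.const_mul (2 * ε^2)))
      ((hfi'.add (hhi'.const_mul ε)).aestronglyMeasurable.pow 2)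
      (Filter.Eventually.of_forall fun s => ?_)
    simp only [Pi.add_apply]
    rw [Real.norm_eq_abs, abs_of_nonneg (sq_nonneg _)]
    nlinarith [sq_nonneg (fm s - ε * hm s)]
  · have hd : ∀ x ∈ Icc (0:ℝ) 1, iteratedDerivWithin (p+1-1) (fun x => f x + ε * h x) (Icc 0 1) x =
        iteratedDerivWithin (p+1-1) f (Icc 0 1) x + ε * iteratedDerivWithin (p+1-1) h (Icc 0 1) x := by
      intro x hx
      rw [iteratedDerivWithin_fun_add hx hud (hfc x hx) (h1 x hx), iteratedDerivWithin_const_mul_field]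
    intro x hx
    have hs : uIcc 0 x ⊆ uIcc (0:ℝ) 1 := by
      rw [uIcc_of_le hx.1, uIcc_of_le zero_le_one]; exact Icc_subset_Icc_right hx.2
    rw [hd x hx, hd 0 (by simp), hfr x hx, hhr x hx, intervalIntegral.integral_add (hfi.mono_set hs)
      ((hhi.mono_set hs).const_mul ε), intervalIntegral.integral_const_mul]
    ring

lemma aux_smooth (p : ℕ) (H : ℝ → ℝ) (hH : ContDiff ℝ (p+1 : ℕ) H) :
    MemW (p+1) H (iteratedDeriv (p+1) H) ∧
      IntervalIntegrable (iteratedDeriv (p+1) H) volume 0 1 ∧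
      ∀ k ≤ p, iteratedDerivWithin k H (Icc 0 1) 1 = iteratedDeriv k H 1 := by
  have hud : UniqueDiffOn ℝ (Icc (0:ℝ) 1) := uniqueDiffOn_Icc zero_lt_one
  have hc : Continuous (iteratedDeriv (p+1) H) := hH.continuous_iteratedDeriv _ le_rfl
  have he : ∀ k ≤ p, ∀ x ∈ Icc (0:ℝ) 1, iteratedDerivWithin k H (Icc 0 1) x = iteratedDeriv k H x := by
    intro k hk x hx
    exact iteratedDerivWithin_eq_iteratedDeriv hud
      (hH.contDiffAt.of_le (by exact_mod_cast (by omega : k ≤ p + 1))) hx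
  refine ⟨⟨(hH.of_le (by exact_mod_cast (by omega : p + 1 - 1 ≤ p + 1))).contDiffOn, ?_, ?_⟩,
    hc.intervalIntegrable _ _, fun k hk => he k hk 1 (by simp)⟩
  · exact (hc.pow 2).continuousOn.integrableOn_compact isCompact_Icc
  · intro x hx
    simp only [Nat.add_sub_cancel]
    rw [he p le_rfl x hx, he p le_rfl 0 (by simp)]
    rw [intervalIntegral.integral_eq_sub_of_hasDerivAt (f := iteratedDeriv p H)]
    · ring
    · intro s _
      rw [iteratedDeriv_succ]
      exact ((hH.differentiable_iteratedDeriv p (by exact_mod_cast (by omega : p < p + 1))) s).hasDerivAt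
    · exact hc.intervalIntegrable _ _

lemma aux_antideriv (q : ℕ) (φ : ℝ → ℝ) (hφ : Continuous φ) :
    ∃ H : ℝ → ℝ, ContDiff ℝ q H ∧ iteratedDeriv q H = φ := by
  induction q generalizing φ with
  | zero => exact ⟨φ, by simpa using hφ, by simp⟩
  | succ q ih =>
    obtain ⟨G, hG, hGφ⟩ := ih φ hφ
    have hd : ∀ x, HasDerivAt (fun x => ∫ s in (0:ℝ)..x, G s) (G x) x := fun x =>
      intervalIntegral.integral_hasDerivAt_right (hG.continuous.intervalIntegrable _ _)
        (hG.continuous.stronglyMeasurableAtFilter _ _) hG.continuous.continuousAt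
    have hde : deriv (fun x => ∫ s in (0:ℝ)..x, G s) = G := funext fun x => (hd x).deriv
    refine ⟨fun x => ∫ s in (0:ℝ)..x, G s, ?_, ?_⟩
    · push_cast
      rw [contDiff_succ_iff_deriv]
      refine ⟨fun x => (hd x).differentiableAt, by simp, by rwa [hde]⟩
    · rw [iteratedDeriv_succ', hde, hGφ]

lemma aux_expand (p n : ℕ) (t y : Fin n → ℝ) (σ ρ : ℝ → ℝ) (lam : ℝ)
    (hWint : ∀ g gm : ℝ → ℝ, MemW (p+1) g gm →
      IntervalIntegrable (fun s => ρ s * gm s ^ 2) volume 0 1)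
    {f fm h hm : ℝ → ℝ} (hf : MemW (p+1) f fm) (hh : MemW (p+1) h hm)
    (hfi : IntervalIntegrable fm volume 0 1) (hhi : IntervalIntegrable hm volume 0 1) :
    IntervalIntegrable (fun s => ρ s * fm s * hm s) volume 0 1 ∧
    ∀ ε : ℝ, psi n t y σ ρ lam (fun x => f x + ε * h x) (fun x => fm x + ε * hm x) =
      psi n t y σ ρ lam f fm + 2 * ε * ((1 / n) * ∑ i, (σ (t i) ^ 2)⁻¹ * (f (t i) - y i) * h (t i)
        + lam * ∫ s in (0:ℝ)..1, ρ s * fm s * hm s) +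
      ε ^ 2 * ((1 / n) * ∑ i, (σ (t i) ^ 2)⁻¹ * h (t i) ^ 2 +
        lam * ∫ s in (0:ℝ)..1, ρ s * hm s ^ 2) := by
  have i1 := hWint _ _ hf
  have i2 := hWint _ _ hh
  have i3 := hWint _ _ (aux_memLin p hf hh hfi hhi 1)
  have i4 : IntervalIntegrable (fun s => ρ s * fm s * hm s) volume 0 1 := by
    have := ((i3.sub i1).sub i2).const_mul (1/2)
    refine this.congr (fun s _ => ?_)
    ring
  refine ⟨i4, fun ε => ?_⟩
  have e1 : ∫ s in (0:ℝ)..1, ρ s * (fm s + ε * hm s) ^ 2 =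
      (∫ s in (0:ℝ)..1, ρ s * fm s ^ 2) + 2 * ε * (∫ s in (0:ℝ)..1, ρ s * fm s * hm s) +
        ε ^ 2 * ∫ s in (0:ℝ)..1, ρ s * hm s ^ 2 := by
    rw [← intervalIntegral.integral_const_mul, ← intervalIntegral.integral_const_mul,
      ← intervalIntegral.integral_add i1 (i4.const_mul _),
      ← intervalIntegral.integral_add (i1.add (i4.const_mul _)) (i2.const_mul _)]
    congr 1; ext s; ring
  have e2 : ∑ i, (σ (t i) ^ 2)⁻¹ * (y i - (f (t i) + ε * h (t i))) ^ 2 =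
      ∑ i, (σ (t i) ^ 2)⁻¹ * (y i - f (t i)) ^ 2 +
      2 * ε * (∑ i, (σ (t i) ^ 2)⁻¹ * (f (t i) - y i) * h (t i)) +
      ε ^ 2 * ∑ i, (σ (t i) ^ 2)⁻¹ * h (t i) ^ 2 := by
    rw [Finset.mul_sum, Finset.mul_sum, ← Finset.sum_add_distrib, ← Finset.sum_add_distrib]
    refine Finset.sum_congr rfl fun i _ => ?_
    ring
  simp only [psi]
  rw [e1, e2]
  ring

lemma aux_var (p n : ℕ) (t y : Fin n → ℝ) (ht : ∀ i, t i ∈ Icc (0 : ℝ) 1) (σ ρ : ℝ → ℝ) (lam : ℝ)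
    {f fm h hm : ℝ → ℝ} (hh : MemW (p+1) h hm) (hhi : IntervalIntegrable hm volume 0 1)
    (hLi : IntervalIntegrable (fun s => lcheck n t σ (fun i => f (t i) - y i) p s * hm s) volume 0 1)
    (hi : IntervalIntegrable (fun s => ρ s * fm s * hm s) volume 0 1) :
    (1 / n) * ∑ i, (σ (t i) ^ 2)⁻¹ * (f (t i) - y i) * h (t i)
        + lam * ∫ s in (0:ℝ)..1, ρ s * fm s * hm s =
      ∑ k ∈ Finset.range (p+1), (-1:ℝ)^k * lcheck n t σ (fun i => f (t i) - y i) k 1 *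
        iteratedDerivWithin k h (Icc 0 1) 1 +
      ∫ s in (0:ℝ)..1, ((-1:ℝ)^(p+1) * lcheck n t σ (fun i => f (t i) - y i) p s
        + lam * ρ s * fm s) * hm s := by
  rw [aux_formula' n t ht σ (fun i => f (t i) - y i) p h hm hh hhi, add_assoc]
  congr 1
  rw [← intervalIntegral.integral_const_mul, ← intervalIntegral.integral_const_mul,
    ← intervalIntegral.integral_add (hLi.const_mul _) (hi.const_mul _)]
  congr 1; ext s; ring

lemma aux_rho (p : ℕ) (ρ : ℝ → ℝ) (hWint : ∀ g gm : ℝ → ℝ, MemW (p+1) g gm →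
      IntervalIntegrable (fun s => ρ s * gm s ^ 2) volume 0 1) :
    IntervalIntegrable ρ volume 0 1 := by
  obtain ⟨H, hH, hH1⟩ := aux_antideriv (p+1) (fun _ => 1) continuous_const
  have := hWint _ _ (aux_smooth p H hH).1
  rw [hH1] at this
  simpa using this

lemma aux_poly (k : ℕ) : ContDiff ℝ ⊤ (fun x : ℝ => (x - 1) ^ k) ∧
    (∀ j, j ≠ k → iteratedDeriv j (fun x : ℝ => (x - 1) ^ k) 1 = 0) ∧
    iteratedDeriv k (fun x : ℝ => (x - 1) ^ k) 1 ≠ 0 ∧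
    ∀ j, k < j → iteratedDeriv j (fun x : ℝ => (x - 1) ^ k) = fun _ => 0 := by
  have h : ∀ j, iteratedDeriv j (fun x : ℝ => (x - 1) ^ k) =
      fun x => (k.descFactorial j : ℝ) * (x - 1) ^ (k - j) := by
    intro j
    ext x
    have := iteratedDeriv_comp_sub_const j (fun x : ℝ => x ^ k) 1
    rw [this]
    simp [iteratedDeriv_eq_iterate, iter_deriv_pow]
  refine ⟨by fun_prop, ?_, ?_, ?_⟩
  · intro j hj
    rw [h]
    rcases lt_or_gt_of_ne hj with h1 | h1
    · have : k - j ≠ 0 := by omega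
      simp [this]
    · simp [Nat.descFactorial_of_lt h1]
  · rw [h]
    simp [Nat.descFactorial_self, Nat.factorial_ne_zero]
  · intro j hj
    rw [h, Nat.descFactorial_of_lt hj]
    simp

lemma aux_quad {V Q : ℝ} (h : ∀ ε : ℝ, 0 ≤ 2 * ε * V + ε ^ 2 * Q) : V = 0 := by
  by_contra hV
  have hQ : 0 ≤ Q := by have := h 1; have := h (-1); linarith
  have h1 := h (-V / (Q + 1))
  have h2 : 2 * (-V / (Q + 1)) * V + (-V / (Q + 1)) ^ 2 * Q = - (V ^ 2 * (Q + 2)) / (Q + 1) ^ 2 := by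
    field_simp; ring
  rw [h2] at h1
  have : 0 < (V ^ 2 * (Q + 2)) / (Q + 1) ^ 2 := by positivity
  rw [neg_div] at h1
  linarith

lemma aux_Ioc_Icc : (volume.restrict (Ioc (0:ℝ) 1)) = volume.restrict (Icc (0:ℝ) 1) :=
  Measure.restrict_congr_set Ioc_ae_eq_Icc

lemma aux_fwd (p n : ℕ) (t y : Fin n → ℝ) (ht : ∀ i, t i ∈ Icc (0 : ℝ) 1)
    (σ ρ : ℝ → ℝ) (hρ : ∀ x ∈ Icc (0 : ℝ) 1, 0 < ρ x)
    (lam : ℝ) (hlam : 0 < lam)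
    (f fm : ℝ → ℝ) (hf : MemW (p+1) f fm)
    (hWint : ∀ g gm : ℝ → ℝ, MemW (p+1) g gm →
      IntervalIntegrable (fun s => ρ s * gm s ^ 2) volume 0 1)
    (hmin : ∀ g gm : ℝ → ℝ, MemW (p+1) g gm →
        psi n t y σ ρ lam f fm ≤ psi n t y σ ρ lam g gm) :
    (∀ᵐ x ∂(volume.restrict (Icc (0 : ℝ) 1)),
      (-1:ℝ)^(p+1) * lcheck n t σ (fun i => f (t i) - y i) p x + lam * ρ x * fm x = 0) ∧
    ∀ k ≤ p, lcheck n t σ (fun i => f (t i) - y i) k 1 = 0 := by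
  -- measurability of fm
  have hfi : IntervalIntegrable fm volume 0 1 := by
    obtain ⟨S, hS, hSi⟩ := aux_trunc p f fm hf
    have h1 := hmin _ _ hS
    have i1 := hWint _ _ hf
    have i2 := hWint _ _ hS
    simp only [psi] at h1
    have h2 : ∫ s in (0:ℝ)..1, ρ s * fm s ^ 2 ≤ ∫ s in (0:ℝ)..1, ρ s * (S.indicator fm s) ^ 2 :=
      le_of_mul_le_mul_left (by linarith) hlam
    have h3 : ∫ s in (0:ℝ)..1, (ρ s * fm s ^ 2 - ρ s * (S.indicator fm s) ^ 2) ≤ 0 := by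
      rw [intervalIntegral.integral_sub i1 i2]; linarith
    rw [intervalIntegral.integral_of_le zero_le_one] at h3
    have hnn : 0 ≤ᵐ[volume.restrict (Ioc (0:ℝ) 1)]
        fun s => (ρ s * fm s ^ 2 - ρ s * (S.indicator fm s) ^ 2) := by
      filter_upwards [ae_restrict_mem measurableSet_Ioc] with s hs
      have := hρ s (Ioc_subset_Icc_self hs)
      by_cases h : s ∈ S
      · simp [h]
      · simp [h]; positivity
    have h4 := (integral_eq_zero_iff_of_nonneg_ae hnn (i1.sub i2).1).1
      (le_antisymm h3 (integral_nonneg_of_ae hnn))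
    refine hSi.congr_ae ?_
    rw [uIoc_of_le zero_le_one]
    filter_upwards [h4, ae_restrict_mem measurableSet_Ioc] with s h5 hs
    have h6 := hρ s (Ioc_subset_Icc_self hs)
    by_cases h : s ∈ S
    · simp [h]
    · simp only [h, not_false_eq_true, indicator_of_notMem, Pi.zero_apply, ne_eq, OfNat.ofNat_ne_zero,
        zero_pow, mul_zero, sub_zero, mul_eq_zero, pow_eq_zero_iff] at h5 ⊢
      rcases h5 with h5 | h5
      · exact absurd h5 h6.ne'
      · exact h5.symm
  set L := lcheck n t σ (fun i => f (t i) - y i) with hL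
  -- first variation vanishes on smooth functions
  have hV : ∀ H : ℝ → ℝ, ContDiff ℝ (p+1 : ℕ) H →
      ∑ k ∈ Finset.range (p+1), (-1:ℝ)^k * L k 1 * iteratedDeriv k H 1 +
      ∫ s in (0:ℝ)..1, ((-1:ℝ)^(p+1) * L p s + lam * ρ s * fm s) * iteratedDeriv (p+1) H s = 0 := by
    intro H hH
    obtain ⟨hM, hi, he⟩ := aux_smooth p H hH
    obtain ⟨hint, hex⟩ := aux_expand p n t y σ ρ lam hWint hf hM hfi hi
    have hv := aux_var p n t y ht σ ρ lam (f := f) (fm := fm) hM hi ?_ hint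
    · have hsum : ∑ k ∈ Finset.range (p+1), (-1:ℝ)^k * L k 1 * iteratedDeriv k H 1 =
          ∑ k ∈ Finset.range (p+1), (-1:ℝ)^k * L k 1 * iteratedDerivWithin k H (Icc 0 1) 1 := by
        refine Finset.sum_congr rfl fun k hk => ?_
        rw [he k (by simpa [Nat.lt_succ_iff] using hk)]
      rw [hsum, ← hv]
      refine aux_quad (Q := ((1 / n) * ∑ i, (σ (t i) ^ 2)⁻¹ * H (t i) ^ 2 +
        lam * ∫ s in (0:ℝ)..1, ρ s * iteratedDeriv (p+1) H s ^ 2)) fun ε => ?_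
      have h1 := hmin _ _ (aux_memLin p hf hM hfi hi ε)
      rw [hex ε] at h1
      linarith
    · exact (lcheck_int n t σ _ p 0 1).mul_continuousOn
        (hH.continuous_iteratedDeriv (p+1) le_rfl).continuousOn
  have hb : ∀ k ≤ p, L k 1 = 0 := by
    intro k hk
    obtain ⟨h1, h2, h3, h4⟩ := aux_poly k
    have h5 := hV _ (h1.of_le le_top)
    rw [h4 (p+1) (by omega), Finset.sum_eq_single k] at h5
    · simpa [h3] using h5
    · intro j _ hj
      rw [h2 j hj, mul_zero]
    · intro h; simp at h; omega
  refine ⟨?_, hb⟩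
  have hq : IntervalIntegrable (fun s => (-1:ℝ)^(p+1) * L p s + lam * ρ s * fm s) volume 0 1 := by
    refine ((lcheck_int n t σ _ p 0 1).const_mul _).add ?_
    obtain ⟨H, hH, hH1⟩ := aux_antideriv (p+1) (fun _ => 1) continuous_const
    obtain ⟨hM, hi, he⟩ := aux_smooth p H hH
    obtain ⟨hint, hex⟩ := aux_expand p n t y σ ρ lam hWint hf hM hfi hi
    rw [hH1] at hint
    refine (hint.const_mul lam).congr (fun s _ => ?_)
    ring
  have hq' := hq
  rw [intervalIntegrable_iff_integrableOn_Ioc_of_le zero_le_one] at hq'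
  have := isOpen_Ioo.ae_eq_zero_of_integral_contDiff_smul_eq_zero (U := Ioo (0:ℝ) 1) (μ := volume)
    (hq'.mono_set Ioo_subset_Ioc_self).locallyIntegrableOn (fun g hg _ hgs => by
      obtain ⟨H, hH, hH1⟩ := aux_antideriv (p+1) g hg.continuous
      have h1 := hV H hH
      rw [hH1, Finset.sum_eq_zero, zero_add, intervalIntegral.integral_of_le zero_le_one,
        setIntegral_eq_integral_of_forall_compl_eq_zero] at h1
      · simpa only [smul_eq_mul, mul_comm] using h1
      · intro x hx
        have : x ∉ tsupport g := fun h => hx (Ioo_subset_Ioc_self (hgs h))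
        rw [image_eq_zero_of_notMem_tsupport this, mul_zero]
      · intro k hk
        rw [hb k (by simpa [Nat.lt_succ_iff] using hk)]; simp)
  rw [← Measure.restrict_congr_set (Ioo_ae_eq_Icc (a := (0:ℝ)) (b := 1)),
    ae_restrict_iff' measurableSet_Ioo]
  exact this

lemma aux_bwd (p n : ℕ) (t y : Fin n → ℝ) (ht : ∀ i, t i ∈ Icc (0 : ℝ) 1)
    (σ ρ : ℝ → ℝ) (hρ : ∀ x ∈ Icc (0 : ℝ) 1, 0 < ρ x)
    (lam : ℝ) (hlam : 0 < lam)
    (f fm : ℝ → ℝ) (hf : MemW (p+1) f fm)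
    (hWint : ∀ g gm : ℝ → ℝ, MemW (p+1) g gm →
      IntervalIntegrable (fun s => ρ s * gm s ^ 2) volume 0 1)
    (h1 : ∀ᵐ x ∂(volume.restrict (Icc (0 : ℝ) 1)),
      (-1:ℝ)^(p+1) * lcheck n t σ (fun i => f (t i) - y i) p x + lam * ρ x * fm x = 0)
    (h2 : ∀ k ≤ p, lcheck n t σ (fun i => f (t i) - y i) k 1 = 0)
    (g gm : ℝ → ℝ) (hg : MemW (p+1) g gm) :
    psi n t y σ ρ lam f fm ≤ psi n t y σ ρ lam g gm := by
  rw [← aux_Ioc_Icc] at h1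
  have hpm : ((-1:ℝ)^(p+1)) * (-1:ℝ)^(p+1) = 1 := by rw [← mul_pow]; simp
  have hfi : IntervalIntegrable fm volume 0 1 := by
    refine aux_sq_int (by simp) ?_ hf.2.1
    have hr := (aux_rho p ρ hWint).1.aestronglyMeasurable.aemeasurable
    have hl := (lcheck_int n t σ (fun i => f (t i) - y i) p 0 1).1.aestronglyMeasurable.aemeasurable
    refine (((hl.const_mul (-(-1:ℝ)^(p+1))).div (hr.const_mul lam)).congr ?_).aestronglyMeasurable
    filter_upwards [h1, ae_restrict_mem measurableSet_Ioc] with s h5 hs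
    have h6 := hρ s (Ioc_subset_Icc_self hs)
    simp only [Pi.div_apply]
    rw [div_eq_iff (by positivity)]
    linarith
  obtain ⟨S, hS, hSi⟩ := aux_trunc p g gm hg
  have hle : psi n t y σ ρ lam g (S.indicator gm) ≤ psi n t y σ ρ lam g gm := by
    simp only [psi]
    gcongr
    apply intervalIntegral.integral_mono_on zero_le_one (hWint _ _ hS) (hWint _ _ hg)
    intro s hs
    have h6 := hρ s hs
    by_cases h : s ∈ S
    · simp [h]
    · simp [h]; positivity
  refine le_trans ?_ hle
  have hh := aux_memLin p hS hf hSi hfi (-1)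
  have hhi : IntervalIntegrable (fun x => S.indicator gm x + (-1) * fm x) volume 0 1 :=
    hSi.add (hfi.const_mul _)
  obtain ⟨hint, hex⟩ := aux_expand p n t y σ ρ lam hWint hf hh hfi hhi
  have hv := aux_var p n t y ht σ ρ lam (f := f) (fm := fm) hh hhi ?_ hint
  · have z1 : ∑ k ∈ Finset.range (p+1), (-1:ℝ)^k * lcheck n t σ (fun i => f (t i) - y i) k 1 *
        iteratedDerivWithin k (fun x => g x + (-1) * f x) (Icc 0 1) 1 = 0 := by
      refine Finset.sum_eq_zero fun k hk => ?_
      rw [h2 k (by simpa [Nat.lt_succ_iff] using hk)]; simp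
    have z2 : ∫ s in (0:ℝ)..1, ((-1:ℝ)^(p+1) * lcheck n t σ (fun i => f (t i) - y i) p s
        + lam * ρ s * fm s) * (S.indicator gm s + (-1) * fm s) = 0 := by
      apply intervalIntegral.integral_zero_ae
      rw [ae_restrict_iff' measurableSet_Ioc] at h1
      filter_upwards [h1] with s hs hs'
      rw [uIoc_of_le zero_le_one] at hs'
      rw [hs hs', zero_mul]
    rw [z1, z2, zero_add] at hv
    · have h3 := hex 1
      rw [hv] at h3
      have e1 : (fun x => f x + 1 * (g x + (-1) * f x)) = g := by ext x; ring
      have e2 : (fun x => fm x + 1 * (S.indicator gm x + (-1) * fm x)) = S.indicator gm := by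
        ext x; ring
      rw [e1, e2] at h3
      rw [h3]
      have : 0 ≤ ∫ s in (0:ℝ)..1, ρ s * (S.indicator gm s + (-1) * fm s) ^ 2 := by
        apply intervalIntegral.integral_nonneg zero_le_one
        intro s hs
        have := hρ s hs
        positivity
      have h4 : 0 ≤ (1 / (n:ℝ)) * ∑ i, (σ (t i) ^ 2)⁻¹ * (g (t i) + (-1) * f (t i)) ^ 2 := by
        positivity
      have := mul_nonneg hlam.le this
      linarith
  · refine (hint.const_mul (-(-1:ℝ)^(p+1) * lam)).congr_ae ?_
    rw [uIoc_of_le zero_le_one]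
    filter_upwards [h1] with s hs
    linear_combination (-(-1:ℝ)^(p+1) * (S.indicator gm s + (-1) * fm s)) * hs
      + lcheck n t σ (fun i => f (t i) - y i) p s * (S.indicator gm s + (-1) * fm s) * hpm

/-- Theorem 1 of the paper: `f̂ ∈ W^m_2` minimizes `ψ` over `W^m_2` iff
(i) `(-1)^m λ ρ(t) f̂^{(m)}(t) + ľ_m(f̂,t) = ľ_m(h,t)` for a.e. `t ∈ [0,1]`, and
(ii) `ľ_k(f̂,1) = ľ_k(h,1)` for `k = 1, …, m`.
Here `lcheck … k` is `ľ_{k+1}`, so `ľ_m = lcheck … (m-1)`. -/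
theorem minimizer_characterization
    (m n : ℕ) (hm : 1 ≤ m) (hn : 1 ≤ n)
    (t y : Fin n → ℝ) (ht : ∀ i, t i ∈ Icc (0 : ℝ) 1)
    (σ ρ : ℝ → ℝ)
    (hσ : ∀ x ∈ Icc (0 : ℝ) 1, 0 < σ x) (hρ : ∀ x ∈ Icc (0 : ℝ) 1, 0 < ρ x)
    (lam : ℝ) (hlam : 0 < lam)
    (fhat fhatm : ℝ → ℝ) (hf : MemW m fhat fhatm)
    (hWint : ∀ g gm : ℝ → ℝ, MemW m g gm →
      IntervalIntegrable (fun s => ρ s * gm s ^ 2) volume 0 1) :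
    (∀ g gm : ℝ → ℝ, MemW m g gm →
        psi n t y σ ρ lam fhat fhatm ≤ psi n t y σ ρ lam g gm) ↔
      ((∀ᵐ x ∂(volume.restrict (Icc (0 : ℝ) 1)),
          (-1 : ℝ) ^ m * lam * ρ x * fhatm x +
              lcheck n t σ (fun i => fhat (t i)) (m - 1) x =
            lcheck n t σ y (m - 1) x) ∧
        (∀ k : ℕ, k < m →
          lcheck n t σ (fun i => fhat (t i)) k 1 = lcheck n t σ y k 1)) := by
  obtain ⟨p, rfl⟩ : ∃ p, m = p + 1 := ⟨m - 1, by omega⟩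
  have hpm : ((-1:ℝ)^(p+1)) * (-1:ℝ)^(p+1) = 1 := by rw [← mul_pow]; simp
  have hsub := fun k x => lcheck_sub n t σ (fun i => fhat (t i)) y k x
  simp only [Nat.add_sub_cancel]
  constructor
  · intro hmin
    obtain ⟨h1, h2⟩ := aux_fwd p n t y ht σ ρ hρ lam hlam fhat fhatm hf hWint hmin
    refine ⟨?_, fun k hk => ?_⟩
    · filter_upwards [h1] with x hx
      rw [hsub] at hx
      linear_combination (-1:ℝ)^(p+1) * hx - (lcheck n t σ (fun i => fhat (t i)) p x
        - lcheck n t σ y p x) * hpm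
    · have := h2 k (by omega)
      rw [hsub] at this
      linarith
  · rintro ⟨h1, h2⟩ g gm hg
    refine aux_bwd p n t y ht σ ρ hρ lam hlam fhat fhatm hf hWint ?_ ?_ g gm hg
    · filter_upwards [h1] with x hx
      rw [hsub]
      linear_combination (-1:ℝ)^(p+1) * hx - (lam * ρ x * fhatm x) * hpm
    · intro k hk
      rw [hsub, h2 k (by omega), sub_self]

end
end

section
/- Suppose σ, q, ρ:[0,1]→(0,∞) are continuous, and suppose f̂ ∈ W^m_2 minimizes ψ over W^m_2. Set r(t) = σ(t)²/q(t), define l₁(f, t) = ∫₀ᵗ σ(s)^{-2} f(s) q(s) ds and l_k(f, t) = ∫₀ᵗ l_{k−1}(f, s) ds for 2 ≤ k ≤ m, and set R_m(t) = l_m(f̂, t) − ľ_m(f̂, t). Then the function u(t) = l_m(f̂, t) satisfies, for almost every t ∈ [0,1], the differential equation (−1)^m λ ρ(t) (d^m/dt^m)[ r(t) (d^m/dt^m) u(t) ] + u(t) = ľ_m(h, t) + R_m(t), together with the boundary conditions l_k(f̂, 0) = 0 and l_k(f̂, 1) = ľ_k(h, 1) + R_k(1) for k = 1, …, m, where R_k(t)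 = l_k(f̂, t) − ľ_k(f̂, t). -/
open MeasureTheory Set

noncomputable section

/-- The iterated population integrals: `lcont σ q f k` is `l_{k+1}(f, ·)` from the paper,
with `l₁(f, x) = ∫₀ˣ σ(s)⁻² f(s) q(s) ds` and `l_{k+1}(f, x) = ∫₀ˣ l_k(f, s) ds`. -/
def lcont (σ q : ℝ → ℝ) (f : ℝ → ℝ) : ℕ → ℝ → ℝ
  | 0 => fun x => ∫ s in (0 : ℝ)..x, (σ s ^ 2)⁻¹ * f s * q s
  | (k + 1) => fun x => ∫ s in (0 : ℝ)..x, lcont σ q f k s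

def Jint (p : ℝ → ℝ) : ℕ → ℝ → ℝ
  | 0 => p
  | (k + 1) => fun x => ∫ s in (1 : ℝ)..x, Jint p k s

lemma Jint_ii {p : ℝ → ℝ} (hp : ∀ a b, IntervalIntegrable p volume a b) (k : ℕ) :
    ∀ a b, IntervalIntegrable (Jint p k) volume a b := by
  induction k with
  | zero => exact hp
  | succ k ih =>
    intro a b
    exact (intervalIntegral.continuous_primitive ih 1).intervalIntegrable a b

lemma Jint_cont {p : ℝ → ℝ} (hp : ∀ a b, IntervalIntegrable p volume a b) (k : ℕ) :
    Continuous (Jint p (k + 1)) :=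
  intervalIntegral.continuous_primitive (Jint_ii hp k) 1

lemma Jint_hasDeriv {p : ℝ → ℝ} (k : ℕ) (hc : Continuous (Jint p k)) (x : ℝ) :
    HasDerivAt (Jint p (k + 1)) (Jint p k x) x :=
  intervalIntegral.integral_hasDerivAt_right (hc.intervalIntegrable _ _)
    hc.stronglyMeasurable.stronglyMeasurableAtFilter hc.continuousAt

lemma Jint_contDiff {p : ℝ → ℝ} (hp : ∀ a b, IntervalIntegrable p volume a b) (k : ℕ) :
    ContDiff ℝ (k : ℕ) (Jint p (k + 1)) := by
  induction k with
  | zero => exact_mod_cast contDiff_zero.2 (Jint_cont hp 0)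
  | succ k ih =>
    have h := Jint_hasDeriv (k + 1) (Jint_cont hp k)
    push_cast
    rw [contDiff_succ_iff_deriv]
    refine ⟨fun x => (h x).differentiableAt, by simp, ?_⟩
    rw [show deriv (Jint p (k + 1 + 1)) = Jint p (k + 1) from funext fun x => (h x).deriv]
    exact ih

lemma Jint_iter {p : ℝ → ℝ} (k : ℕ) (hp : ∀ j, Continuous (Jint p (k + j))) (i : ℕ) :
    iteratedDeriv i (Jint p (k + i)) = Jint p k := by
  induction i with
  | zero => simp
  | succ i ih =>
    rw [iteratedDeriv_succ', ← ih]
    congr 1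
    exact funext fun x => (Jint_hasDeriv (k + i) (hp i) x).deriv

lemma ibp {p Q : ℝ → ℝ} (hp : IntervalIntegrable p volume 0 1)
    (hQ : IntervalIntegrable Q volume 0 1) :
    ∫ x in (0:ℝ)..1, (∫ s in (1:ℝ)..x, p s) * Q x =
      - ∫ x in (0:ℝ)..1, p x * ∫ s in (0:ℝ)..x, Q s := by
  have h1 := hp.absolutelyContinuousOnInterval_intervalIntegral (c := 1) (by simp)
  have h2 := hQ.absolutelyContinuousOnInterval_intervalIntegral (c := 0) (by simp)
  have h3 := h1.integral_mul_deriv_eq_deriv_mul h2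
  simp only [intervalIntegral.integral_same, zero_mul, mul_zero, sub_zero, zero_sub] at h3
  have e1 : ∫ x in (0:ℝ)..1, (∫ s in (1:ℝ)..x, p s) * Q x =
      ∫ x in (0:ℝ)..1, (∫ s in (1:ℝ)..x, p s) * deriv (fun x => ∫ s in (0:ℝ)..x, Q s) x := by
    apply intervalIntegral.integral_congr_ae
    filter_upwards [hQ.ae_hasDerivAt_integral] with x hx hx1
    rw [(hx (uIoc_subset_uIcc hx1) 0 (by simp)).deriv]
  have e2 : ∫ x in (0:ℝ)..1, deriv (fun x => ∫ s in (1:ℝ)..x, p s) x * (∫ s in (0:ℝ)..x, Q s) =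
      ∫ x in (0:ℝ)..1, p x * ∫ s in (0:ℝ)..x, Q s := by
    apply intervalIntegral.integral_congr_ae
    filter_upwards [hp.ae_hasDerivAt_integral] with x hx hx1
    rw [(hx (uIoc_subset_uIcc hx1) 1 (by simp)).deriv]
  rw [e1, h3, e2]

lemma lcheck_ii (n : ℕ) (t : Fin n → ℝ) (σ : ℝ → ℝ) (v : Fin n → ℝ) (k : ℕ) :
    ∀ a b, IntervalIntegrable (lcheck n t σ v k) volume a b := by
  induction k with
  | zero =>
    intro a b
    unfold lcheck
    refine IntervalIntegrable.const_mul ?_ _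
    have : (fun x => ∑ i, (σ (t i) ^ 2)⁻¹ * v i * (if t i ≤ x then (1:ℝ) else 0)) =
        ∑ i, (fun x => (σ (t i) ^ 2)⁻¹ * v i * (if t i ≤ x then (1:ℝ) else 0)) := by
      ext x; simp
    rw [this]
    refine IntervalIntegrable.sum _ fun i _ => ?_
    refine IntervalIntegrable.const_mul ?_ _
    apply Monotone.intervalIntegrable
    intro x y hxy
    dsimp only
    split_ifs <;> first | (exfalso; linarith) | norm_num
  | succ k ih =>
    intro a b
    exact (intervalIntegral.continuous_primitive ih 0).intervalIntegrable a b

lemma lcheck_bdd (n : ℕ) (t : Fin n → ℝ) (σ : ℝ → ℝ) (v : Fin n → ℝ) (k : ℕ) :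
    ∃ C, ∀ x ∈ Icc (0:ℝ) 1, |lcheck n t σ v k x| ≤ C := by
  cases k with
  | zero =>
    refine ⟨|1 / (n:ℝ)| * ∑ i, |(σ (t i) ^ 2)⁻¹ * v i|, fun x _ => ?_⟩
    simp only [lcheck]
    rw [abs_mul]
    gcongr
    refine (Finset.abs_sum_le_sum_abs _ _).trans (Finset.sum_le_sum fun i _ => ?_)
    split_ifs <;> simp
    positivity
  | succ k =>
    have := (intervalIntegral.continuous_primitive (lcheck_ii n t σ v k) 0)
    obtain ⟨C, hC⟩ := isCompact_Icc.exists_bound_of_continuousOn (s := Icc (0:ℝ) 1) this.continuousOn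
    exact ⟨C, fun x hx => hC x hx⟩

/-- pairing with the empirical functional -/
lemma pair_zero (n : ℕ) (t : Fin n → ℝ) (ht : ∀ i, t i ∈ Icc (0 : ℝ) 1) (σ : ℝ → ℝ)
    (v : Fin n → ℝ) (p : ℝ → ℝ) (hp : ∀ a b, IntervalIntegrable p volume a b) :
    (1 / n : ℝ) * ∑ i, (σ (t i) ^ 2)⁻¹ * v i * (∫ s in (1:ℝ)..(t i), p s) =
      - ∫ s in (0:ℝ)..1, p s * lcheck n t σ v 0 s := by
  have key : ∀ i, IntervalIntegrable (fun s => p s * (if t i ≤ s then (1:ℝ) else 0)) volume 0 1 ∧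
      ∫ s in (0:ℝ)..1, p s * (if t i ≤ s then (1:ℝ) else 0) = - ∫ s in (1:ℝ)..(t i), p s := by
    intro i
    have e : (fun s => p s * (if t i ≤ s then (1:ℝ) else 0)) = (Ici (t i)).indicator p := by
      ext s; simp [indicator]
    rw [e]
    constructor
    · rw [intervalIntegrable_iff]
      exact (intervalIntegrable_iff.1 (hp 0 1)).indicator measurableSet_Ici
    · rw [intervalIntegral.integral_of_le zero_le_one, integral_indicator measurableSet_Ici,
        Measure.restrict_restrict measurableSet_Ici, intervalIntegral.integral_of_ge (ht i).2,
        neg_neg]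
      apply setIntegral_congr_set
      have : ∀ᵐ x : ℝ, x ≠ t i := by simp [ae_iff, measure_singleton]
      have h2 : ∀ᵐ x : ℝ, x ≠ 0 := by simp [ae_iff, measure_singleton]
      filter_upwards [this, h2] with x hx hx0
      apply propext
      change (t i ≤ x ∧ 0 < x ∧ x ≤ 1) ↔ (t i < x ∧ x ≤ 1)
      have := (ht i).1
      constructor
      · rintro ⟨h1, h2, h3⟩; exact ⟨lt_of_le_of_ne h1 (Ne.symm hx), h3⟩
      · rintro ⟨h1, h3⟩; exact ⟨h1.le, by linarith, h3⟩
  simp only [lcheck]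
  have : ∀ s, p s * ((1 / n : ℝ) * ∑ i, (σ (t i) ^ 2)⁻¹ * v i * (if t i ≤ s then (1:ℝ) else 0)) =
      (1 / n : ℝ) * ∑ i, (σ (t i) ^ 2)⁻¹ * v i * (p s * (if t i ≤ s then (1:ℝ) else 0)) := by
    intro s
    rw [mul_left_comm, Finset.mul_sum]
    congr 1
    exact Finset.sum_congr rfl fun i _ => by ring
  simp only [this]
  rw [intervalIntegral.integral_const_mul, intervalIntegral.integral_finsetSum
    (fun i _ => (key i).1.const_mul _), ← mul_neg, ← Finset.sum_neg_distrib]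
  congr 1
  refine Finset.sum_congr rfl fun i _ => ?_
  rw [intervalIntegral.integral_const_mul, (key i).2]
  ring

lemma pair_gen (n : ℕ) (t : Fin n → ℝ) (ht : ∀ i, t i ∈ Icc (0 : ℝ) 1) (σ : ℝ → ℝ)
    (v : Fin n → ℝ) (p : ℝ → ℝ) (hp : ∀ a b, IntervalIntegrable p volume a b) (j k : ℕ) :
    (1 / n : ℝ) * ∑ i, (σ (t i) ^ 2)⁻¹ * v i * Jint p (j + k + 1) (t i) =
      (-1) ^ (k + 1) * ∫ s in (0:ℝ)..1, Jint p j s * lcheck n t σ v k s := by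
  induction k generalizing j with
  | zero =>
    have := pair_zero n t ht σ v (Jint p j) (Jint_ii hp j)
    simpa [Jint] using this
  | succ k ih =>
    have := ih (j + 1)
    rw [show j + (k + 1) + 1 = j + 1 + k + 1 by ring, this]
    have h := ibp (Jint_ii hp j 0 1) (lcheck_ii n t σ v k 0 1)
    change ∫ x in (0:ℝ)..1, Jint p (j+1) x * lcheck n t σ v k x =
      - ∫ x in (0:ℝ)..1, Jint p j x * lcheck n t σ v (k+1) x at h
    rw [h]; ring

lemma memW_J (k : ℕ) {p : ℝ → ℝ} (hp : ∀ a b, IntervalIntegrable p volume a b)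
    (hp2 : IntegrableOn (fun s => p s ^ 2) (Icc (0 : ℝ) 1) volume) :
    MemW (k + 1) (Jint p (k + 1)) p := by
  have hc := Jint_contDiff hp k
  have hit : ∀ x ∈ Icc (0:ℝ) 1,
      iteratedDerivWithin k (Jint p (k + 1)) (Icc 0 1) x = Jint p 1 x := by
    intro x hx
    rw [iteratedDerivWithin_eq_iteratedDeriv (uniqueDiffOn_Icc zero_lt_one) hc.contDiffAt hx]
    have := Jint_iter (p := p) 1 (fun j => by rw [add_comm]; exact Jint_cont hp j) k
    rw [add_comm k 1, this]
  refine ⟨hc.contDiffOn, hp2, fun x hx => ?_⟩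
  simp only [Nat.add_sub_cancel]
  rw [hit x hx, hit 0 (by simp)]
  simp only [Jint]
  rw [intervalIntegral.integral_add_adjacent_intervals (hp _ _) (hp _ _)]

lemma one_ii : ∀ a b, IntervalIntegrable (fun _ : ℝ => (1:ℝ)) volume a b :=
  fun _ _ => intervalIntegrable_const

lemma Jone_cont (k : ℕ) : Continuous (Jint (fun _ => 1) k) := by
  cases k with
  | zero => exact continuous_const
  | succ k => exact Jint_cont one_ii k

lemma Jone_contDiff (k : ℕ) : ContDiff ℝ (⊤ : ℕ∞) (Jint (fun _ => 1) k) := by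
  induction k with
  | zero => exact contDiff_const
  | succ k ih =>
    have h := Jint_hasDeriv (p := fun _ => 1) k (Jone_cont k)
    rw [contDiff_infty_iff_deriv]
    refine ⟨fun x => (h x).differentiableAt, ?_⟩
    rw [show deriv (Jint (fun _ => 1) (k + 1)) = Jint (fun _ => 1) k from
      funext fun x => (h x).deriv]
    exact ih

lemma memW_one (m k : ℕ) (hk : k < m) : MemW m (Jint (fun _ => 1) k) (fun _ => 0) := by
  have hc : ContDiff ℝ ((m - 1 : ℕ)) (Jint (fun _ => 1) k) :=
    contDiff_infty.1 (Jone_contDiff k) (m - 1)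
  refine ⟨hc.contDiffOn, by simp, fun x hx => ?_⟩
  have key : ∃ c : ℝ, iteratedDeriv (m - 1) (Jint (fun _ => 1) k) = fun _ => c := by
    obtain ⟨i, hi⟩ : ∃ i, m - 1 = i + k := ⟨m - 1 - k, by omega⟩
    have := Jint_iter (p := fun _ => 1) 0 (fun j => Jone_cont _) k
    rw [zero_add] at this
    rw [hi, iteratedDeriv_eq_iterate, Function.iterate_add_apply, ← iteratedDeriv_eq_iterate,
      ← iteratedDeriv_eq_iterate, this]
    cases i with
    | zero => exact ⟨1, by simp [Jint]⟩
    | succ i => refine ⟨0, ?_⟩; ext x; simp [Jint, iteratedDeriv_const]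
  obtain ⟨c, hcc⟩ := key
  rw [iteratedDerivWithin_eq_iteratedDeriv (uniqueDiffOn_Icc zero_lt_one) hc.contDiffAt hx,
    iteratedDerivWithin_eq_iteratedDeriv (uniqueDiffOn_Icc zero_lt_one) hc.contDiffAt (by simp),
    hcc]
  simp

lemma memLp_ii {f : ℝ → ℝ} (hf : MemLp f 2 (volume.restrict (Icc (0:ℝ) 1))) (x : ℝ)
    (hx : x ∈ Icc (0:ℝ) 1) : IntervalIntegrable f volume 0 x := by
  have h : IntegrableOn f (Icc 0 1) volume := hf.integrable (by norm_num)
  rw [intervalIntegrable_iff, uIoc_of_le hx.1]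
  exact h.mono_set (Ioc_subset_Icc_self.trans (Icc_subset_Icc_right hx.2))

lemma memW_add {m : ℕ} {f fm g gm : ℝ → ℝ} (hf : MemW m f fm) (hg : MemW m g gm)
    (hfm : MemLp fm 2 (volume.restrict (Icc (0:ℝ) 1)))
    (hgm : MemLp gm 2 (volume.restrict (Icc (0:ℝ) 1))) (c : ℝ) :
    MemW m (fun x => f x + c * g x) (fun x => fm x + c * gm x) := by
  have hcg : ContDiffOn ℝ (m - 1 : ℕ) (fun x => c * g x) (Icc 0 1) := contDiffOn_const.mul hg.1
  refine ⟨hf.1.add hcg, ?_, ?_⟩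
  · exact (hfm.add (hgm.const_mul c)).integrable_sq
  · have key : ∀ x ∈ Icc (0:ℝ) 1, iteratedDerivWithin (m - 1) (fun x => f x + c * g x) (Icc 0 1) x
        = iteratedDerivWithin (m - 1) f (Icc 0 1) x +
          c * iteratedDerivWithin (m - 1) g (Icc 0 1) x := by
      intro x hx
      rw [iteratedDerivWithin_fun_add hx (uniqueDiffOn_Icc zero_lt_one) (hf.1 x hx) (hcg x hx),
        iteratedDerivWithin_const_mul_field]
    intro x hx
    rw [key x hx, key 0 (by simp), hf.2.2 x hx, hg.2.2 x hx,
      intervalIntegral.integral_add (memLp_ii hfm x hx) ((memLp_ii hgm x hx).const_mul c),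
      intervalIntegral.integral_const_mul]
    ring

lemma quad_zero {A B : ℝ} (h : ∀ c : ℝ, 0 ≤ c * A + c ^ 2 * B) : A = 0 := by
  by_contra hA
  have hB : 0 < |B| + 1 := by positivity
  have h1 := h (-A / (|B| + 1))
  have h2 : (-A / (|B| + 1)) * A + (-A / (|B| + 1)) ^ 2 * B =
      (A / (|B| + 1)) ^ 2 * (B - (|B| + 1)) := by
    field_simp
    ring
  rw [h2] at h1
  have h3 : 0 < (A / (|B| + 1)) ^ 2 := by positivity
  have := le_abs_self B
  nlinarith

lemma rho_mul_ii {ρ f g : ℝ → ℝ} (hρc : ContinuousOn ρ (Icc 0 1))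
    (hf : MemLp f 2 (volume.restrict (Icc (0:ℝ) 1)))
    (hg : MemLp g 2 (volume.restrict (Icc (0:ℝ) 1))) :
    IntervalIntegrable (fun s => ρ s * (f s * g s)) volume 0 1 := by
  have h : IntegrableOn (fun s => f s * g s) (Icc 0 1) volume := hf.integrable_mul hg
  have h' : IntervalIntegrable (fun s => f s * g s) volume 0 1 := by
    rw [intervalIntegrable_iff, uIoc_of_le zero_le_one]
    exact h.mono_set Ioc_subset_Icc_self
  exact h'.continuousOn_mul (by rwa [uIcc_of_le zero_le_one])

lemma euler (m n : ℕ) (t y : Fin n → ℝ) (σ ρ : ℝ → ℝ) (hρc : ContinuousOn ρ (Icc 0 1))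
    (lam : ℝ) (f fm : ℝ → ℝ) (hf : MemW m f fm)
    (hmin : ∀ g gm : ℝ → ℝ, MemW m g gm → psi n t y σ ρ lam f fm ≤ psi n t y σ ρ lam g gm)
    (hfm : MemLp fm 2 (volume.restrict (Icc (0:ℝ) 1)))
    (g gm : ℝ → ℝ) (hg : MemW m g gm) (hgm : MemLp gm 2 (volume.restrict (Icc (0:ℝ) 1))) :
    (1 / n : ℝ) * ∑ i, (σ (t i) ^ 2)⁻¹ * (y i - f (t i)) * g (t i) =
      lam * ∫ s in (0:ℝ)..1, ρ s * (fm s * gm s) := by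
  have key : ∀ c : ℝ, 0 ≤ c * (2 * (lam * (∫ s in (0:ℝ)..1, ρ s * (fm s * gm s)) -
      (1 / n : ℝ) * ∑ i, (σ (t i) ^ 2)⁻¹ * (y i - f (t i)) * g (t i))) +
      c ^ 2 * (lam * (∫ s in (0:ℝ)..1, ρ s * (gm s * gm s)) +
        (1 / n : ℝ) * ∑ i, (σ (t i) ^ 2)⁻¹ * g (t i) ^ 2) := by
    intro c
    have h := hmin _ _ (memW_add hf hg hfm hgm c)
    unfold psi at h
    have e1 : ∫ s in (0:ℝ)..1, ρ s * (fm s + c * gm s) ^ 2 =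
        (∫ s in (0:ℝ)..1, ρ s * fm s ^ 2) + 2 * c * (∫ s in (0:ℝ)..1, ρ s * (fm s * gm s)) +
          c ^ 2 * ∫ s in (0:ℝ)..1, ρ s * (gm s * gm s) := by
      have i1 := rho_mul_ii hρc hfm hfm
      have i2 := rho_mul_ii hρc hfm hgm
      have i3 := rho_mul_ii hρc hgm hgm
      rw [← intervalIntegral.integral_const_mul, ← intervalIntegral.integral_const_mul]
      simp only [pow_two (fm _)]
      rw [← intervalIntegral.integral_add i1 (i2.const_mul _),
        ← intervalIntegral.integral_add (i1.add (i2.const_mul _)) (i3.const_mul _)]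
      congr 1
      ext s
      ring
    have e2 : ∑ i, (σ (t i) ^ 2)⁻¹ * (y i - (f (t i) + c * g (t i))) ^ 2 =
        ∑ i, (σ (t i) ^ 2)⁻¹ * (y i - f (t i)) ^ 2 -
          2 * c * (∑ i, (σ (t i) ^ 2)⁻¹ * (y i - f (t i)) * g (t i)) +
          c ^ 2 * ∑ i, (σ (t i) ^ 2)⁻¹ * g (t i) ^ 2 := by
      rw [Finset.mul_sum, Finset.mul_sum, ← Finset.sum_sub_distrib, ← Finset.sum_add_distrib]
      exact Finset.sum_congr rfl fun i _ => by ring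
    rw [e1, e2] at h
    linear_combination h
  have := quad_zero key
  linarith

lemma memLp_of_sq {f : ℝ → ℝ} {s : Set ℝ} (h : AEStronglyMeasurable f (volume.restrict s))
    (h2 : IntegrableOn (fun x => f x ^ 2) s volume) : MemLp f 2 (volume.restrict s) :=
  (memLp_two_iff_integrable_sq h).2 h2

lemma minimizer_memLp (m n : ℕ) (t y : Fin n → ℝ) (σ ρ : ℝ → ℝ)
    (hρc : ContinuousOn ρ (Icc 0 1)) (hρ : ∀ x ∈ Icc (0 : ℝ) 1, 0 < ρ x)
    (lam : ℝ) (hlam : 0 < lam) (f fm : ℝ → ℝ) (hf : MemW m f fm)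
    (hmin : ∀ g gm : ℝ → ℝ, MemW m g gm → psi n t y σ ρ lam f fm ≤ psi n t y σ ρ lam g gm) :
    MemLp fm 2 (volume.restrict (Icc (0:ℝ) 1)) := by
  by_contra hcon
  have hsq := hf.2.1
  -- integrability up to one gives the claim
  have h1 : ¬ IntervalIntegrable fm volume 0 1 := by
    intro h
    rw [intervalIntegrable_iff, uIoc_of_le zero_le_one, ← integrableOn_Icc_iff_integrableOn_Ioc] at h
    exact hcon (memLp_of_sq h.aestronglyMeasurable hsq)
  set S : Set ℝ := {x | x ∈ Icc (0:ℝ) 1 ∧ IntervalIntegrable fm volume 0 x} with hS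
  have hS0 : (0:ℝ) ∈ S := ⟨by simp, IntervalIntegrable.refl⟩
  have hSb : BddAbove S := ⟨1, fun x hx => hx.1.2⟩
  set a := sSup S with ha
  have ha0 : 0 ≤ a := le_csSup hSb hS0
  have ha1 : a ≤ 1 := csSup_le ⟨0, hS0⟩ fun x hx => hx.1.2
  have haS : IntervalIntegrable fm volume 0 a := by
    obtain ⟨u, -, hut, huS⟩ := exists_seq_tendsto_sSup ⟨0, hS0⟩ hSb
    rw [intervalIntegrable_iff, uIoc_of_le ha0, integrableOn_Ioc_iff_integrableOn_Ioo]
    have hsub : Ioo 0 a ⊆ ⋃ k, Ioc 0 (u k) := by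
      intro x hx
      obtain ⟨k, hk⟩ := (hut.eventually (lt_mem_nhds hx.2)).exists
      exact mem_iUnion.2 ⟨k, hx.1, hk.le⟩
    have hmeas : AEStronglyMeasurable fm (volume.restrict (Ioo 0 a)) := by
      refine AEStronglyMeasurable.mono_set hsub ?_
      rw [aestronglyMeasurable_iUnion_iff]
      intro k
      have := (huS k).2
      rw [intervalIntegrable_iff, uIoc_of_le (huS k).1.1] at this
      exact this.aestronglyMeasurable
    have hss : Ioo 0 a ⊆ Icc (0:ℝ) 1 := fun x hx => ⟨hx.1.le, hx.2.le.trans ha1⟩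
    have : IsFiniteMeasure (volume.restrict (Ioo 0 a)) := ⟨by simp⟩
    exact (memLp_of_sq hmeas (hsq.mono_set hss)).integrable (by norm_num)
  have halt : a < 1 := lt_of_le_of_ne ha1 fun h => h1 (h ▸ haS)
  set F := iteratedDerivWithin (m - 1) f (Icc (0 : ℝ) 1) with hF
  have hFc : ContinuousOn F (Icc 0 1) :=
    hf.1.continuousOn_iteratedDerivWithin le_rfl (uniqueDiffOn_Icc zero_lt_one)
  have hbey : ∀ x ∈ Ioc a 1, F x = F 0 := by
    intro x hx
    have hx0 : x ∈ Icc (0:ℝ) 1 := ⟨ha0.trans hx.1.le, hx.2⟩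
    rw [hF, hf.2.2 x hx0, intervalIntegral.integral_undef, add_zero]
    intro hi
    exact absurd (le_csSup hSb ⟨hx0, hi⟩) (not_le.2 hx.1)
  have hFa : F a = F 0 := by
    have hc : Filter.Tendsto F (nhdsWithin a (Ioc a 1)) (nhds (F a)) :=
      (hFc a ⟨ha0, ha1⟩).mono_left (nhdsWithin_mono _ fun x hx => ⟨ha0.trans hx.1.le, hx.2⟩)
    have : (nhdsWithin a (Ioc a 1)).NeBot := by
      rw [nhdsWithin_Ioc_eq_nhdsGT halt]; infer_instance
    have hc2 : Filter.Tendsto F (nhdsWithin a (Ioc a 1)) (nhds (F 0)) :=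
      tendsto_const_nhds.congr' (by
        filter_upwards [self_mem_nhdsWithin] with x hx using (hbey x hx).symm)
    exact tendsto_nhds_unique hc hc2
  have hInt0 : ∫ s in (0:ℝ)..a, fm s = 0 := by
    have := hf.2.2 a ⟨ha0, ha1⟩
    rw [← hF, hFa] at this
    linarith
  set gm : ℝ → ℝ := (Iic a).indicator fm with hgm
  have hgmi : IntegrableOn gm (Ioc 0 1) volume := by
    rw [hgm, integrableOn_indicator_iff measurableSet_Iic]
    rw [intervalIntegrable_iff, uIoc_of_le ha0] at haS
    exact haS.mono_set fun x hx => ⟨hx.2.1, hx.1⟩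
  have hgsq : (fun s => gm s ^ 2) = (Iic a).indicator (fun s => fm s ^ 2) := by
    ext s
    simp only [hgm, indicator]
    split_ifs <;> simp
  have hgsqi : IntegrableOn (fun s => gm s ^ 2) (Icc (0:ℝ) 1) volume := by
    rw [hgsq]; exact hsq.indicator measurableSet_Iic
  have hgW : MemW m f gm := by
    refine ⟨hf.1, hgsqi, fun x hx => ?_⟩
    have hlow : ∀ z, 0 ≤ z → z ≤ a → ∫ s in (0:ℝ)..z, gm s = ∫ s in (0:ℝ)..z, fm s := by
      intro z hz0 hza
      apply intervalIntegral.integral_congr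
      intro s hs
      rw [uIcc_of_le hz0] at hs
      simp only [hgm]
      exact indicator_of_mem (show s ∈ Iic a from hs.2.trans hza) _
    rcases le_or_gt x a with hxa | hxa
    · rw [hlow x hx.1 hxa]; exact hf.2.2 x hx
    · change F x = F 0 + _
      have i1 : IntervalIntegrable gm volume 0 a := by
        rw [intervalIntegrable_iff, uIoc_of_le ha0]
        exact hgmi.mono_set (Ioc_subset_Ioc_right ha1)
      have i2 : IntervalIntegrable gm volume a x := by
        rw [intervalIntegrable_iff, uIoc_of_le hxa.le]
        exact hgmi.mono_set (Ioc_subset_Ioc ha0 hx.2)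
      have z2 : ∫ s in a..x, gm s = 0 := by
        rw [intervalIntegral.integral_of_le hxa.le]
        apply setIntegral_eq_zero_of_forall_eq_zero
        intro s hs
        simp only [hgm]
        exact indicator_of_notMem (show s ∉ Iic a from not_le.2 hs.1) _
      rw [hbey x ⟨hxa, hx.2⟩, ← intervalIntegral.integral_add_adjacent_intervals i1 i2, z2,
        hlow a ha0 le_rfl, hInt0]
      simp
  have hle := hmin f gm hgW
  unfold psi at hle
  have hle2 : ∫ s in (0:ℝ)..1, ρ s * fm s ^ 2 ≤ ∫ s in (0:ℝ)..1, ρ s * gm s ^ 2 :=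
    le_of_mul_le_mul_left (by linarith) hlam
  have toII : ∀ h : ℝ → ℝ, IntegrableOn h (Icc (0:ℝ) 1) volume →
      IntervalIntegrable (fun s => ρ s * h s) volume 0 1 := by
    intro h hh
    have h' : IntervalIntegrable h volume 0 1 := by
      rw [intervalIntegrable_iff, uIoc_of_le zero_le_one]
      exact hh.mono_set Ioc_subset_Icc_self
    exact h'.continuousOn_mul (by rwa [uIcc_of_le zero_le_one])
  have j1 := toII _ hsq
  have j2 := toII _ hgsqi
  have hdiff : ∫ s in (0:ℝ)..1, (ρ s * fm s ^ 2 - ρ s * gm s ^ 2) ≤ 0 := by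
    rw [intervalIntegral.integral_sub j1 j2]; linarith
  have jd := j1.sub j2
  rw [intervalIntegrable_iff, uIoc_of_le zero_le_one] at jd
  rw [intervalIntegral.integral_of_le zero_le_one] at hdiff
  have hnn : ∀ s ∈ Ioc (0:ℝ) 1, 0 ≤ ρ s * fm s ^ 2 - ρ s * gm s ^ 2 := by
    intro s hs
    have := (hρ s ⟨hs.1.le, hs.2⟩).le
    simp only [hgm, indicator]
    split_ifs
    · simp
    · simp; positivity
  have hnn' : 0 ≤ᵐ[volume.restrict (Ioc (0:ℝ) 1)] fun s => ρ s * fm s ^ 2 - ρ s * gm s ^ 2 :=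
    (ae_restrict_iff' measurableSet_Ioc).2 (Filter.Eventually.of_forall hnn)
  have hz := (setIntegral_eq_zero_iff_of_nonneg_ae hnn' jd).1
    (le_antisymm hdiff (integral_nonneg_of_ae hnn'))
  have hae : gm =ᵐ[volume.restrict (Ioc (0:ℝ) 1)] fm := by
    filter_upwards [hz, ae_restrict_mem measurableSet_Ioc] with s hs hs1
    have hp := hρ s ⟨hs1.1.le, hs1.2⟩
    simp only [hgm, indicator, Pi.zero_apply] at hs ⊢
    split_ifs at hs ⊢ with h
    · rfl
    · have : ρ s * fm s ^ 2 = 0 := by simpa using hs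
      rcases mul_eq_zero.1 this with h | h
      · exact absurd h hp.ne'
      · exact (pow_eq_zero_iff two_ne_zero).1 h |>.symm
  apply h1
  rw [intervalIntegrable_iff, uIoc_of_le zero_le_one]
  exact Integrable.congr hgmi hae

lemma prim_hasDeriv {P : ℝ → ℝ} (hP : ContinuousOn P (Icc 0 1)) {x : ℝ} (hx : x ∈ Ioo (0:ℝ) 1) :
    HasDerivAt (fun x => ∫ s in (0:ℝ)..x, P s) (P x) x := by
  have hn : Icc (0:ℝ) 1 ∈ nhds x := Icc_mem_nhds hx.1 hx.2
  refine intervalIntegral.integral_hasDerivAt_right ?_ ?_ (hP.continuousAt hn)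
  · apply ContinuousOn.intervalIntegrable
    rw [uIcc_of_le hx.1.le]
    exact hP.mono (Icc_subset_Icc_right hx.2.le)
  · exact ⟨Icc 0 1, hn, hP.aestronglyMeasurable measurableSet_Icc⟩

lemma prim_cont {P : ℝ → ℝ} (hP : ContinuousOn P (Icc 0 1)) :
    ContinuousOn (fun x => ∫ s in (0:ℝ)..x, P s) (Icc 0 1) := by
  have := intervalIntegral.continuousOn_primitive_interval (a := 0) (b := 1) (f := P)
    (μ := volume) (by rw [uIcc_of_le zero_le_one]; exact hP.integrableOn_Icc)
  rwa [uIcc_of_le zero_le_one] at this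

lemma lcont_cont {σ q f : ℝ → ℝ}
    (hw : ContinuousOn (fun s => (σ s ^ 2)⁻¹ * f s * q s) (Icc 0 1)) (k : ℕ) :
    ContinuousOn (lcont σ q f k) (Icc 0 1) := by
  induction k with
  | zero => exact prim_cont hw
  | succ k ih => exact prim_cont ih

lemma lcont_iter {σ q f : ℝ → ℝ}
    (hw : ContinuousOn (fun s => (σ s ^ 2)⁻¹ * f s * q s) (Icc 0 1)) (k : ℕ) :
    ∀ x ∈ Ioo (0:ℝ) 1,
      iteratedDeriv (k + 1) (lcont σ q f k) x = (σ x ^ 2)⁻¹ * f x * q x := by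
  induction k with
  | zero =>
    intro x hx
    rw [zero_add, iteratedDeriv_one]
    exact (prim_hasDeriv hw hx).deriv
  | succ k ih =>
    intro x hx
    rw [iteratedDeriv_succ', ← ih x hx]
    apply Filter.EventuallyEq.iteratedDeriv_eq
    filter_upwards [Ioo_mem_nhds hx.1 hx.2] with z hz
    exact (prim_hasDeriv (lcont_cont hw k) hz).deriv

/-- if `σ, q, ρ` are continuous and positive on `[0,1]` and `f̂ ∈ W^m_2`
minimizes `ψ`, then `u = l_m(f̂, ·)` solves, a.e. on `[0,1]`, the two-point boundary
value problem
`(-1)^m λ ρ(t) (d^m/dt^m)[r(t) (d^m/dt^m) u(t)] + u(t) = ľ_m(h,t) + R_m(t)`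
with `r = σ²/q`, `R_k = l_k(f̂,·) - ľ_k(f̂,·)`, and boundary conditions
`l_k(f̂,0) = 0`, `l_k(f̂,1) = ľ_k(h,1) + R_k(1)` for `k = 1, …, m`.
Here `lcont … (m-1)` is `l_m` and `lcheck … (m-1)` is `ľ_m`. -/
theorem boundary_value_problem_representation
    (m n : ℕ) (hm : 1 ≤ m) (hn : 1 ≤ n)
    (t y : Fin n → ℝ) (ht : ∀ i, t i ∈ Icc (0 : ℝ) 1)
    (σ q ρ : ℝ → ℝ)
    (hσc : ContinuousOn σ (Icc 0 1)) (hqc : ContinuousOn q (Icc 0 1))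
    (hρc : ContinuousOn ρ (Icc 0 1))
    (hσ : ∀ x ∈ Icc (0 : ℝ) 1, 0 < σ x) (hq : ∀ x ∈ Icc (0 : ℝ) 1, 0 < q x)
    (hρ : ∀ x ∈ Icc (0 : ℝ) 1, 0 < ρ x)
    (lam : ℝ) (hlam : 0 < lam)
    (fhat fhatm : ℝ → ℝ) (hf : MemW m fhat fhatm)
    (hmin : ∀ g gm : ℝ → ℝ, MemW m g gm →
      psi n t y σ ρ lam fhat fhatm ≤ psi n t y σ ρ lam g gm) :
    (∀ᵐ x ∂(volume.restrict (Icc (0 : ℝ) 1)),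
        (-1 : ℝ) ^ m * lam * ρ x *
            iteratedDeriv m
              (fun s => (σ s ^ 2 / q s) * iteratedDeriv m (lcont σ q fhat (m - 1)) s) x +
          lcont σ q fhat (m - 1) x =
        lcheck n t σ y (m - 1) x +
          (lcont σ q fhat (m - 1) x - lcheck n t σ (fun i => fhat (t i)) (m - 1) x)) ∧
    (∀ k : ℕ, k < m → lcont σ q fhat k 0 = 0) ∧
    (∀ k : ℕ, k < m →
      lcont σ q fhat k 1 =
        lcheck n t σ y k 1 +
          (lcont σ q fhat k 1 - lcheck n t σ (fun i => fhat (t i)) k 1)) := by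
  obtain ⟨k, rfl⟩ : ∃ k, m = k + 1 := ⟨m - 1, by omega⟩
  have hfm := minimizer_memLp _ n t y σ ρ hρc hρ lam hlam fhat fhatm hf hmin
  have hel := euler _ n t y σ ρ hρc lam fhat fhatm hf hmin hfm
  have hfc : ContinuousOn fhat (Icc 0 1) := hf.1.continuousOn
  have hw : ContinuousOn (fun s => (σ s ^ 2)⁻¹ * fhat s * q s) (Icc 0 1) :=
    (((hσc.pow 2).inv₀ fun x hx => (pow_pos (hσ x hx) 2).ne').mul hfc).mul hqc
  refine ⟨?_, ?_, ?_⟩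
  · simp only [Nat.add_sub_cancel]
    set L := lcheck n t σ (fun i => y i - fhat (t i)) k with hL
    -- the identity for the top derivative
    set d : ℝ → ℝ := fun s => lam * (ρ s * fhatm s) - (-1) ^ (k + 1) * L s with hd
    have hLm : MemLp L 2 (volume.restrict (Icc (0:ℝ) 1)) := by
      obtain ⟨C, hC⟩ := lcheck_bdd n t σ (fun i => y i - fhat (t i)) k
      have hii := lcheck_ii n t σ (fun i => y i - fhat (t i)) k 0 1
      rw [intervalIntegrable_iff, uIoc_of_le zero_le_one,
        ← integrableOn_Icc_iff_integrableOn_Ioc] at hii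
      refine MemLp.of_bound hii.aestronglyMeasurable C ?_
      exact (ae_restrict_iff' measurableSet_Icc).2 (Filter.Eventually.of_forall hC)
    have hρf : MemLp (fun s => ρ s * fhatm s) 2 (volume.restrict (Icc (0:ℝ) 1)) := by
      obtain ⟨C, hC⟩ := isCompact_Icc.exists_bound_of_continuousOn (s := Icc (0:ℝ) 1) hρc
      refine hfm.of_le_mul (c := C)
        ((hρc.aestronglyMeasurable measurableSet_Icc).mul hfm.aestronglyMeasurable) ?_
      refine (ae_restrict_iff' measurableSet_Icc).2 (Filter.Eventually.of_forall fun x hx => ?_)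
      rw [norm_mul]
      exact mul_le_mul_of_nonneg_right (hC x hx) (norm_nonneg _)
    have hdm : MemLp d 2 (volume.restrict (Icc (0:ℝ) 1)) :=
      (hρf.const_mul lam).sub (hLm.const_mul _)
    set gm : ℝ → ℝ := (Icc (0:ℝ) 1).indicator d with hgm
    have hgd : ∀ s ∈ Icc (0:ℝ) 1, gm s = d s := fun s hs => indicator_of_mem hs _
    have hgm2 : MemLp gm 2 (volume.restrict (Icc (0:ℝ) 1)) := hdm.indicator measurableSet_Icc
    have hgint : Integrable gm volume := by
      rw [hgm, integrable_indicator_iff measurableSet_Icc]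
      exact hdm.integrable (by norm_num)
    have hgii : ∀ a b, IntervalIntegrable gm volume a b := fun a b => hgint.intervalIntegrable
    have hgW := memW_J k hgii hgm2.integrable_sq
    have h1 := hel _ _ hgW hgm2
    have h2 := pair_gen n t ht σ (fun i => y i - fhat (t i)) gm hgii 0 k
    rw [zero_add] at h2
    rw [h2] at h1
    have hLg : IntervalIntegrable (fun s => gm s * L s) volume 0 1 := by
      rw [intervalIntegrable_iff, uIoc_of_le zero_le_one]
      exact IntegrableOn.mono_set (hgm2.integrable_mul hLm) Ioc_subset_Icc_self
    have h3 : ∫ s in (0:ℝ)..1, d s ^ 2 = 0 := by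
      have e : ∫ s in (0:ℝ)..1, d s ^ 2 = ∫ s in (0:ℝ)..1,
          (lam * (ρ s * (fhatm s * gm s)) - (-1) ^ (k + 1) * (gm s * L s)) := by
        apply intervalIntegral.integral_congr
        intro s hs
        rw [uIcc_of_le zero_le_one] at hs
        simp only [hgd s hs, hd]
        ring
      rw [e, intervalIntegral.integral_sub ((rho_mul_ii hρc hfm hgm2).const_mul _)
        (hLg.const_mul _), intervalIntegral.integral_const_mul,
        intervalIntegral.integral_const_mul, ← h1]
      simp only [Jint, ← hL, sub_self]
    rw [intervalIntegral.integral_of_le zero_le_one, ← integral_Icc_eq_integral_Ioc] at h3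
    have h4 := (setIntegral_eq_zero_iff_of_nonneg_ae
      (Filter.Eventually.of_forall fun s => sq_nonneg (d s)) hdm.integrable_sq).1 h3
    have hfi := memLp_ii hfm 1 (by simp)
    have n0 : ∀ᵐ x : ℝ, x ≠ 0 := by simp [ae_iff, measure_singleton]
    have n1 : ∀ᵐ x : ℝ, x ≠ 1 := by simp [ae_iff, measure_singleton]
    filter_upwards [h4, ae_restrict_mem measurableSet_Icc, ae_restrict_of_ae n0,
      ae_restrict_of_ae n1, ae_restrict_of_ae hfi.ae_hasDerivAt_integral]
      with x hx4 hx hx0 hx1 hxd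
    have hxo : x ∈ Ioo (0:ℝ) 1 := ⟨lt_of_le_of_ne hx.1 (Ne.symm hx0), lt_of_le_of_ne hx.2 hx1⟩
    rw [uIcc_of_le zero_le_one] at hxd
    have hxd' := hxd hx 0 (by simp)
    have hG : ∀ s ∈ Ioo (0:ℝ) 1,
        (σ s ^ 2 / q s) * iteratedDeriv (k + 1) (lcont σ q fhat k) s = fhat s := by
      intro s hs
      have hs' := Ioo_subset_Icc_self hs
      rw [lcont_iter hw k s hs]
      have := (hσ s hs').ne'
      have := (hq s hs').ne'
      field_simp
    have hder : iteratedDeriv (k + 1)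
        (fun s => (σ s ^ 2 / q s) * iteratedDeriv (k + 1) (lcont σ q fhat k) s) x = fhatm x := by
      rw [iteratedDeriv_succ]
      refine HasDerivAt.deriv ?_
      refine (hxd'.const_add (iteratedDerivWithin k fhat (Icc (0 : ℝ) 1) 0)).congr_of_eventuallyEq ?_
      filter_upwards [Ioo_mem_nhds hxo.1 hxo.2] with z hz
      have hz' := Ioo_subset_Icc_self hz
      have e1 : iteratedDeriv k
          (fun s => (σ s ^ 2 / q s) * iteratedDeriv (k + 1) (lcont σ q fhat k) s) z =
          iteratedDeriv k fhat z := by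
        apply Filter.EventuallyEq.iteratedDeriv_eq
        filter_upwards [Ioo_mem_nhds hz.1 hz.2] with s hs using hG s hs
      rw [e1, ← iteratedDerivWithin_eq_iteratedDeriv (n := k) (uniqueDiffOn_Icc zero_lt_one)
        (hf.1.contDiffAt (Icc_mem_nhds hz.1 hz.2)) hz']
      exact hf.2.2 z hz'
    rw [hder]
    have hdx : d x = 0 := (pow_eq_zero_iff two_ne_zero).1 hx4
    have hLx := lcheck_sub n t σ y (fun i => fhat (t i)) k x
    rw [← hL] at hLx
    have hsgn : ((-1 : ℝ) ^ (k + 1)) * (-1) ^ (k + 1) = 1 := by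
      rw [← mul_pow]; simp
    simp only [hd] at hdx
    linear_combination (-1 : ℝ) ^ (k + 1) * hdx + hLx + L x * hsgn
  · intro j _
    cases j <;> simp [lcont]
  · intro j hj
    have h1 := hel _ _ (memW_one (k + 1) j hj) MemLp.zero'
    simp only [mul_zero, intervalIntegral.integral_zero] at h1
    have h2 : lcheck n t σ (fun i => y i - fhat (t i)) j 1 = 0 := by
      cases j with
      | zero =>
        simp only [lcheck]
        rw [← h1]
        simp [Jint, (ht _).2]
      | succ j =>
        have h3 := pair_gen n t ht σ (fun i => y i - fhat (t i)) (fun _ => 1) one_ii 0 j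
        rw [zero_add, h1] at h3
        rcases mul_eq_zero.1 h3.symm with h | h
        · exact absurd h (by positivity)
        · simpa [Jint, lcheck] using h
    rw [lcheck_sub] at h2
    linarith

end
end
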